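/- arXiv:2107.04032 — 4 statements merged into one kernel-verified Lean document; each statement's English description precedes it below -/
import Mathlib

section
/- Let n ≥ 2, let W be a real n²×n² matrix and c ∈ ℝ^{n²}, and set λ⁰ := (1/2)(Σ_{i,j=1}^{n²} |W_{i,j}| + Σ_{i=1}^{n²} |c_i|). Then for every λ > λ⁰, a binary vector x ∈ {0,1}^{n²} minimizes f(x) = xᵀWx + cᵀx + λ‖Ax − b‖² over all binary vectors if and only if x = vec(X) for a permutation matrix X minimizing xᵀWx + cᵀx over vectorizations of permutation matrices; in particular every minimizer of the penalized problem satisfies Ax = b. -/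
open Finset in
/-- The squared deviations of the row and column sums of an integer matrix from `1` add up to an
even number. -/
theorem two_dvd_sum_sq_deviation {ι : Type*} [Fintype ι] (z : ι × ι → ℤ) :
    (2 : ℤ) ∣ (∑ j, ((∑ i, z (i, j)) - 1) ^ 2) + ∑ i, ((∑ j, z (i, j)) - 1) ^ 2 := by
  have key : ∀ g : ι → ℤ, (2 : ℤ) ∣ (∑ j, (g j - 1) ^ 2) - ∑ j, (g j - 1) := by
    intro g
    rw [← sum_sub_distrib]
    refine dvd_sum fun j _ => ?_
    have h := (Int.even_mul_pred_self (g j - 1)).two_dvd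
    rwa [show (g j - 1) ^ 2 - (g j - 1) = (g j - 1) * (g j - 1 - 1) by ring]
  have h₁ := key fun j => ∑ i, z (i, j)
  have h₂ := key fun i => ∑ j, z (i, j)
  have h₃ : ∑ j, ((∑ i, z (i, j)) - 1) = ∑ i, ((∑ j, z (i, j)) - 1) := by
    simp only [sum_sub_distrib]
    rw [sum_comm]
  omega

/-- The squared deviations of the row and column sums of a binary matrix from `1` add up to `0`
or to at least `2`. -/
theorem sum_sq_deviation_eq_zero_or_two_le {ι : Type*} [Fintype ι] (x : ι × ι → ℝ)
    (hx : ∀ p, x p = 0 ∨ x p = 1) :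
    (∑ j, ((∑ i, x (i, j)) - 1) ^ 2) + ∑ i, ((∑ j, x (i, j)) - 1) ^ 2 = 0 ∨
      2 ≤ (∑ j, ((∑ i, x (i, j)) - 1) ^ 2) + ∑ i, ((∑ j, x (i, j)) - 1) ^ 2 := by
  have hz : ∀ p, ∃ z : ℤ, x p = z := fun p =>
    (hx p).elim (fun h => ⟨0, by simp [h]⟩) (fun h => ⟨1, by simp [h]⟩)
  choose z hz using hz
  have hdvd := two_dvd_sum_sq_deviation z
  have hnonneg : 0 ≤ (∑ j, ((∑ i, z (i, j)) - 1) ^ 2) + ∑ i, ((∑ j, z (i, j)) - 1) ^ 2 := by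
    positivity
  simp only [hz]
  norm_cast
  omega

theorem sum_sq_deviation_eq_zero_iff {ι : Type*} [Fintype ι] (x : ι × ι → ℝ) :
    (∑ j, ((∑ i, x (i, j)) - 1) ^ 2) + ∑ i, ((∑ j, x (i, j)) - 1) ^ 2 = 0 ↔
      (∀ i, ∑ j, x (i, j) = 1) ∧ ∀ j, ∑ i, x (i, j) = 1 := by
  rw [add_eq_zero_iff_of_nonneg (by positivity) (by positivity),
    Finset.sum_eq_zero_iff_of_nonneg fun _ _ => sq_nonneg _,
    Finset.sum_eq_zero_iff_of_nonneg fun _ _ => sq_nonneg _]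
  simp [sub_eq_zero, and_comm]

/-- Two values of a quadratic function on binary vectors differ by at most the sum of the
absolute values of its coefficients. -/
theorem quadratic_sub_le_of_binary {ι : Type*} [Fintype ι] (W : Matrix ι ι ℝ) (c x y : ι → ℝ)
    (hx : ∀ p, x p = 0 ∨ x p = 1) (hy : ∀ p, y p = 0 ∨ y p = 1) :
    ((∑ p, ∑ q, x p * W p q * x q) + ∑ p, c p * x p) -
      ((∑ p, ∑ q, y p * W p q * y q) + ∑ p, c p * y p) ≤
      (∑ p, ∑ q, |W p q|) + ∑ p, |c p| := by
  rw [add_sub_add_comm]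
  simp only [← Finset.sum_sub_distrib]
  refine add_le_add (Finset.sum_le_sum fun p _ => Finset.sum_le_sum fun q _ => ?_)
    (Finset.sum_le_sum fun p _ => ?_)
  · have h₁ := le_abs_self (W p q)
    have h₂ := neg_abs_le (W p q)
    rcases hx p with a | a <;> rcases hx q with b | b <;> rcases hy p with d | d <;>
      rcases hy q with e | e <;> rw [a, b, d, e] <;> linarith
  · have h₁ := le_abs_self (c p)
    have h₂ := neg_abs_le (c p)
    rcases hx p with a | a <;> rcases hy p with d | d <;> rw [a, d] <;> linarith

/-- Baseline penalty reformulation of the QAP over permutation matrices.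
For `λ > λ⁰ := (1/2)(Σ_{p,q} |W_{p,q}| + Σ_p |c_p|)`, a binary vector
`x ∈ {0,1}^{n²}` (indexed by pairs `(i,j)`, i.e. `x = vec X`) minimizes
`f(x) + λ‖Ax − b‖²` over all binary vectors iff `x = vec X` for a permutation matrix
`X` minimizing `f` over vectorized permutation matrices; here
`f(x) = xᵀWx + cᵀx` and `‖Ax − b‖² = Σ_j (Σ_i x_{i,j} − 1)² + Σ_i (Σ_j x_{i,j} − 1)²`.
In particular, every minimizer of the penalized problem satisfies `Ax = b`,
i.e. the penalty vanishes. -/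
theorem stmt_0 (n : ℕ) (hn : 2 ≤ n)
    (W : Matrix (Fin n × Fin n) (Fin n × Fin n) ℝ) (c : (Fin n × Fin n) → ℝ)
    (f : ((Fin n × Fin n) → ℝ) → ℝ)
    (hf : ∀ x, f x = (∑ p, ∑ q, x p * W p q * x q) + ∑ p, c p * x p)
    (pen : ((Fin n × Fin n) → ℝ) → ℝ)
    (hpen : ∀ x, pen x =
      (∑ j, ((∑ i, x (i, j)) - 1)^2) + ∑ i, ((∑ j, x (i, j)) - 1)^2)
    (lam : ℝ)
    (hlam : lam > (1/2) * ((∑ p, ∑ q, |W p q|) + ∑ p, |c p|)) :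
    (∀ x : (Fin n × Fin n) → ℝ, (∀ p, x p = 0 ∨ x p = 1) →
      ((∀ y : (Fin n × Fin n) → ℝ, (∀ p, y p = 0 ∨ y p = 1) →
          f x + lam * pen x ≤ f y + lam * pen y) ↔
        (∃ X : Matrix (Fin n) (Fin n) ℝ,
          (∀ i j, X i j = 0 ∨ X i j = 1) ∧
          (∀ i, ∑ j, X i j = 1) ∧ (∀ j, ∑ i, X i j = 1) ∧
          (∀ p : Fin n × Fin n, x p = X p.1 p.2) ∧
          (∀ Y : Matrix (Fin n) (Fin n) ℝ,
            (∀ i j, Y i j = 0 ∨ Y i j = 1) →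
            (∀ i, ∑ j, Y i j = 1) → (∀ j, ∑ i, Y i j = 1) →
            f x ≤ f (fun p => Y p.1 p.2))))) ∧
    (∀ x : (Fin n × Fin n) → ℝ, (∀ p, x p = 0 ∨ x p = 1) →
      (∀ y : (Fin n × Fin n) → ℝ, (∀ p, y p = 0 ∨ y p = 1) →
        f x + lam * pen x ≤ f y + lam * pen y) →
      pen x = 0) := by
  have hgap : ∀ x, (∀ p, x p = 0 ∨ x p = 1) → pen x = 0 ∨ 2 ≤ pen x := fun x hx => by
    rw [hpen]
    exact sum_sq_deviation_eq_zero_or_two_le x hx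
  have hzero : ∀ x, pen x = 0 ↔ (∀ i, ∑ j, x (i, j) = 1) ∧ ∀ j, ∑ i, x (i, j) = 1 := fun x => by
    rw [hpen]
    exact sum_sq_deviation_eq_zero_iff x
  have hlam_pos : 0 < lam := lt_of_le_of_lt (by positivity) hlam
  have hlt : ∀ x y, (∀ p, x p = 0 ∨ x p = 1) → (∀ p, y p = 0 ∨ y p = 1) → 2 ≤ pen x →
      f y < f x + lam * pen x := fun x y hx hy h => by
    have hle := quadratic_sub_le_of_binary W c y x hy hx
    rw [← hf, ← hf] at hle
    have := mul_le_mul_of_nonneg_left h hlam_pos.le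
    linarith
  have hpen_min : ∀ x : (Fin n × Fin n) → ℝ, (∀ p, x p = 0 ∨ x p = 1) →
      (∀ y : (Fin n × Fin n) → ℝ, (∀ p, y p = 0 ∨ y p = 1) →
        f x + lam * pen x ≤ f y + lam * pen y) → pen x = 0 := by
    intro x hx hmin
    refine (hgap x hx).resolve_right fun h => ?_
    let e : Fin n × Fin n → ℝ := fun p => if p.1 = p.2 then 1 else 0
    have he : ∀ p, e p = 0 ∨ e p = 1 := fun p => by
      by_cases hp : p.1 = p.2 <;> simp [e, hp]
    have hpe : pen e = 0 := (hzero e).2 ⟨by simp [e], by simp [e]⟩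
    have h₁ := hmin e he
    have h₂ := hlt x e hx he h
    rw [hpe] at h₁
    linarith
  refine ⟨fun x hx => ⟨fun hmin => ?_, ?_⟩, hpen_min⟩
  · have hx0 := hpen_min x hx hmin
    obtain ⟨hrow, hcol⟩ := (hzero x).1 hx0
    refine ⟨fun i j => x (i, j), fun i j => hx _, hrow, hcol, fun _ => rfl,
      fun Y hY hYrow hYcol => ?_⟩
    have h := hmin (fun p => Y p.1 p.2) fun p => hY _ _
    rwa [hx0, (hzero fun p => Y p.1 p.2).2 ⟨hYrow, hYcol⟩, mul_zero, add_zero, add_zero] at h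
  · rintro ⟨X, -, hrow, hcol, hxX, hmin⟩ y hy
    have hx0 : pen x = 0 := (hzero x).2 ⟨by simpa only [hxX] using hrow,
      by simpa only [hxX] using hcol⟩
    rw [hx0, mul_zero, add_zero]
    rcases hgap y hy with h | h
    · obtain ⟨hyrow, hycol⟩ := (hzero y).1 h
      rw [h, mul_zero, add_zero]
      exact hmin (fun i j => y (i, j)) (fun i j => hy _) hyrow hycol
    · exact (hlt y x hy hx h).le
end

section
/- Let n ≥ 2, W a real n²×n² matrix, c ∈ ℝ^{n²}. For each constraint index i ∈ {1,…,2n}, let 𝒥_i ⊆ {1,…,n²} be the set of coordinates of x = vec(X) lying in the row or column of X corresponding to the i-th constraint, and suppose λ_i > D_{𝒥_i} + (1/2) D_{{1,…,n²}} for all i. Then the minimizers of xᵀWx + cᵀx over binary vectors x with Ax = b coincide (as vectors) with the minimizers over all binary x ∈ {0,1}^{n²} of xᵀWx + cᵀx + Σ_{i=1}^{2n} λ_i ((Ax)_i − b_i)². -/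
/-- `D_𝒥 := max_{k ∈ 𝒥} ( Σ_i |W_{k,i} + W_{i,k}| + |W_{k,k}| + |c_k| )`, realized as the
supremum of the (finite, nonempty for the sets of interest) image set. -/
noncomputable def Dmax {n : ℕ} (W : Matrix (Fin n × Fin n) (Fin n × Fin n) ℝ)
    (c : (Fin n × Fin n) → ℝ) (J : Set (Fin n × Fin n)) : ℝ :=
  sSup ((fun k => (∑ i, |W k i + W i k|) + |W k k| + |c k|) '' J)

/-- The set `𝒥` of coordinates of `x = vec X` involved in a given constraint: for the
constraint `Sum.inl j` (the `j`-th column sum) the coordinates in column `j`, and for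
`Sum.inr i` (the `i`-th row sum) the coordinates in row `i`. -/
def constrSet (n : ℕ) : (Fin n ⊕ Fin n) → Set (Fin n × Fin n) :=
  Sum.elim (fun j => {p | p.2 = j}) (fun i => {p | p.1 = i})

section Penalty

variable {ι α β : Type*}

/-- The number of elements of `S` lying over `a` under the map `π`. -/
def lineCard [DecidableEq α] (π : ι → α) (S : Finset ι) (a : α) : ℕ :=
  (S.filter fun p => π p = a).card

/-- The weighted quadratic penalty for the requirement that every fibre of `π` contains
exactly one element of `S`. -/
noncomputable def linePenalty [DecidableEq α] [Fintype α] (π : ι → α) (lam : α → ℝ)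
    (S : Finset ι) : ℝ :=
  ∑ a, lam a * ((lineCard π S a : ℝ) - 1) ^ 2

lemma exists_two_le_of_card_lt [Fintype α] {r : α → ℕ} (h : Fintype.card α < ∑ a, r a) :
    ∃ a, 2 ≤ r a := by
  by_contra! h'
  have := Finset.sum_le_sum fun a (_ : a ∈ Finset.univ) => Nat.le_of_lt_succ (h' a)
  simp at this
  omega

lemma exists_eq_zero_of_lt_card [Fintype α] {r : α → ℕ} (h : ∑ a, r a < Fintype.card α) :
    ∃ a, r a = 0 := by
  by_contra! h'
  have := Finset.sum_le_sum fun a (_ : a ∈ Finset.univ) => Nat.one_le_iff_ne_zero.2 (h' a)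
  simp at this
  omega

lemma eq_one_of_forall_le_one [Fintype α] {r : α → ℕ} (h : ∑ a, r a = Fintype.card α)
    (hr : ∀ a, r a ≤ 1) (a : α) : r a = 1 :=
  (Finset.sum_eq_sum_iff_of_le fun a _ => hr a).1 (by simpa using h) a (Finset.mem_univ a)

lemma eq_one_of_forall_one_le [Fintype α] {r : α → ℕ} (h : ∑ a, r a = Fintype.card α)
    (hr : ∀ a, 1 ≤ r a) (a : α) : r a = 1 :=
  ((Finset.sum_eq_sum_iff_of_le fun a _ => hr a).1 (by simpa using h.symm) a
    (Finset.mem_univ a)).symm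

variable [DecidableEq α]

lemma sum_lineCard [Fintype α] (π : ι → α) (S : Finset ι) : ∑ a, lineCard π S a = S.card :=
  (Finset.card_eq_sum_card_fiberwise fun _ _ => Finset.mem_coe.2 (Finset.mem_univ _)).symm

lemma exists_mem_of_lineCard_pos {π : ι → α} {S : Finset ι} {a : α} (h : 0 < lineCard π S a) :
    ∃ p ∈ S, π p = a := by
  obtain ⟨p, hp⟩ := Finset.card_pos.1 h
  exact ⟨p, Finset.mem_filter.1 hp⟩

lemma lineCard_pos {π : ι → α} {S : Finset ι} {p : ι} (h : p ∈ S) : 0 < lineCard π S (π p) :=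
  Finset.card_pos.2 ⟨p, Finset.mem_filter.2 ⟨h, rfl⟩⟩

lemma eq_of_lineCard_eq_one {π : ι → α} {S : Finset ι} {p q : ι} (hp : p ∈ S) (hq : q ∈ S)
    (hpq : π p = π q) (h : lineCard π S (π q) = 1) : p = q :=
  Finset.card_le_one.1 h.le p (Finset.mem_filter.2 ⟨hp, hpq⟩) q (Finset.mem_filter.2 ⟨hq, rfl⟩)

variable [DecidableEq ι]

lemma lineCard_insert (π : ι → α) {S : Finset ι} {p : ι} (hp : p ∉ S) (a : α) :
    lineCard π (insert p S) a = lineCard π S a + if a = π p then 1 else 0 := by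
  unfold lineCard
  rw [Finset.filter_insert]
  by_cases h : π p = a
  · simp [h, hp]
  · simp [h, Ne.symm h]

lemma lineCard_erase (π : ι → α) {S : Finset ι} {p : ι} (hp : p ∈ S) (a : α) :
    lineCard π S a = lineCard π (S.erase p) a + if a = π p then 1 else 0 := by
  rw [← lineCard_insert π (Finset.notMem_erase p S), Finset.insert_erase hp]

lemma linePenalty_insert [Fintype α] (π : ι → α) (lam : α → ℝ) {S : Finset ι} {p : ι}
    (hp : p ∉ S) :
    linePenalty π lam (insert p S) =
      linePenalty π lam S + lam (π p) * (2 * lineCard π S (π p) - 1) := by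
  have h : lam (π p) * (2 * lineCard π S (π p) - 1) =
      ∑ a, if a = π p then lam a * (2 * (lineCard π S a : ℝ) - 1) else 0 := by simp
  rw [h]
  unfold linePenalty
  rw [← Finset.sum_add_distrib]
  refine Finset.sum_congr rfl fun a _ => ?_
  rw [lineCard_insert π hp]
  split_ifs <;> push_cast <;> ring

variable [DecidableEq β] [Fintype α] [Fintype β] {π : ι → α} {ρ : ι → β} {lr : α → ℝ} {lc : β → ℝ}
  {g : Finset ι → ℝ} {D : ι → ℝ} {M : ℝ}

lemma penalized_insert_le (hg : ∀ S, ∀ p ∉ S, |g (insert p S) - g S| ≤ D p)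
    {S : Finset ι} {p : ι} (hp : p ∉ S) :
    g (insert p S) + linePenalty π lr (insert p S) + linePenalty ρ lc (insert p S) ≤
      g S + linePenalty π lr S + linePenalty ρ lc S + D p
        + lr (π p) * (2 * lineCard π S (π p) - 1) + lc (ρ p) * (2 * lineCard ρ S (ρ p) - 1) := by
  rw [linePenalty_insert π lr hp, linePenalty_insert ρ lc hp]
  linarith [(abs_le.1 (hg S p hp)).2]

lemma penalized_erase_le (hg : ∀ S, ∀ p ∉ S, |g (insert p S) - g S| ≤ D p)
    {S : Finset ι} {p : ι} (hp : p ∈ S) :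
    g (S.erase p) + linePenalty π lr (S.erase p) + linePenalty ρ lc (S.erase p) ≤
      g S + linePenalty π lr S + linePenalty ρ lc S + D p
        - lr (π p) * (2 * lineCard π S (π p) - 3) - lc (ρ p) * (2 * lineCard ρ S (ρ p) - 3) := by
  have h := Finset.notMem_erase p S
  have h1 := linePenalty_insert π lr h
  have h2 := linePenalty_insert ρ lc h
  have h3 := (abs_le.1 (hg _ p h)).1
  have e1 := lineCard_erase π hp (π p)
  have e2 := lineCard_erase ρ hp (ρ p)
  rw [Finset.insert_erase hp] at h1 h2 h3
  rw [if_pos rfl] at e1 e2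
  rw [h1, h2, e1, e2]
  push_cast
  linarith

lemma exists_penalized_lt_of_crowded_of_empty
    (hg : ∀ S, ∀ p ∉ S, |g (insert p S) - g S| ≤ D p)
    (hD : ∀ p, 0 ≤ D p) (hM : ∀ p, D p ≤ M) (hr : ∀ p, D p + M / 2 < lr (π p))
    (hsurj : ∀ a b, ∃ p, π p = a ∧ ρ p = b) {S : Finset ι} {a a' : α}
    (ha : 2 ≤ lineCard π S a) (ha' : lineCard π S a' = 0) (hS : ∀ b, lineCard ρ S b = 1) :
    ∃ T, g T + linePenalty π lr T + linePenalty ρ lc T <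
      g S + linePenalty π lr S + linePenalty ρ lc S := by
  obtain ⟨k, hk, rfl⟩ := exists_mem_of_lineCard_pos (by omega : 0 < lineCard π S a)
  obtain ⟨k', rfl, hk'⟩ := hsurj a' (ρ k)
  have hkS : k' ∉ S := fun h => (lineCard_pos (π := π) h).ne' ha'
  have h1 := penalized_erase_le (π := π) (ρ := ρ) (lr := lr) (lc := lc) hg hk
  have h2 := penalized_insert_le (π := π) (ρ := ρ) (lr := lr) (lc := lc) hg
    (fun h => hkS (Finset.mem_of_mem_erase h) : k' ∉ S.erase k)
  have hne : π k' ≠ π k := fun h => by rw [h] at ha'; omega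
  have e1 := lineCard_erase π hk (π k')
  have e2 := lineCard_erase ρ hk (ρ k)
  rw [if_neg hne, ha'] at e1
  rw [if_pos rfl, hS] at e2
  rw [hk', show lineCard π (S.erase k) (π k') = 0 by omega,
    show lineCard ρ (S.erase k) (ρ k) = 0 by omega] at h2
  rw [hS] at h1
  refine ⟨_, lt_of_le_of_lt h2 ?_⟩
  have ha2 : (2 : ℝ) ≤ lineCard π S (π k) := by exact_mod_cast ha
  have := hr k
  have := hr k'
  have := hD k
  have := hM k
  have : 0 ≤ lr (π k) * (2 * lineCard π S (π k) - 4) :=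
    mul_nonneg (by linarith) (by linarith)
  push_cast at *
  linarith

lemma exists_penalized_lt_of_crowded_of_crowded
    (hg : ∀ S, ∀ p ∉ S, |g (insert p S) - g S| ≤ D p)
    (hD : ∀ p, 0 ≤ D p) (hM : ∀ p, D p ≤ M) (hr : ∀ p, D p + M / 2 < lr (π p))
    (hc : ∀ p, D p + M / 2 < lc (ρ p))
    (hsurj : ∀ a b, ∃ p, π p = a ∧ ρ p = b) {S : Finset ι} {a : α} {b : β}
    (ha : 2 ≤ lineCard π S a) (hb : 2 ≤ lineCard ρ S b) :
    ∃ T, g T + linePenalty π lr T + linePenalty ρ lc T <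
      g S + linePenalty π lr S + linePenalty ρ lc S := by
  by_cases hboth : ∃ p ∈ S, 2 ≤ lineCard π S (π p) ∧ 2 ≤ lineCard ρ S (ρ p)
  · obtain ⟨p, hp, h1, h2⟩ := hboth
    refine ⟨_, lt_of_le_of_lt (penalized_erase_le hg hp) ?_⟩
    have h1' : (2 : ℝ) ≤ lineCard π S (π p) := by exact_mod_cast h1
    have h2' : (2 : ℝ) ≤ lineCard ρ S (ρ p) := by exact_mod_cast h2
    have := hr p
    have := hc p
    have := hD p
    have := hM p
    have : 0 ≤ lr (π p) * (2 * lineCard π S (π p) - 4) :=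
      mul_nonneg (by linarith) (by linarith)
    have : 0 ≤ lc (ρ p) * (2 * lineCard ρ S (ρ p) - 4) :=
      mul_nonneg (by linarith) (by linarith)
    linarith
  push Not at hboth
  obtain ⟨k, hk, rfl⟩ := exists_mem_of_lineCard_pos (by omega : 0 < lineCard π S a)
  obtain ⟨l, hl, rfl⟩ := exists_mem_of_lineCard_pos (by omega : 0 < lineCard ρ S b)
  have hk1 : lineCard ρ S (ρ k) = 1 := by
    have := hboth k hk ha
    have := lineCard_pos (π := ρ) hk
    omega
  have hl1 : lineCard π S (π l) = 1 := by
    by_contra h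
    have := lineCard_pos (π := π) hl
    have := hboth l hl (by omega)
    omega
  obtain ⟨m, hmπ, hmρ⟩ := hsurj (π l) (ρ k)
  have hρ : ρ l ≠ ρ k := fun h => by rw [h] at hb; omega
  have hπ : π l ≠ π k := fun h => by rw [h] at hl1; omega
  have hm : m ∉ S := fun h => hρ (by
    rw [← hmρ, eq_of_lineCard_eq_one h hl hmπ hl1])
  have hlk : l ∈ S.erase k := Finset.mem_erase.2 ⟨fun h => hρ (by rw [h]), hl⟩
  have hm' : m ∉ (S.erase k).erase l := fun h =>
    hm (Finset.mem_of_mem_erase (Finset.mem_of_mem_erase h))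
  have h1 := penalized_erase_le (π := π) (ρ := ρ) (lr := lr) (lc := lc) hg hk
  have h2 := penalized_erase_le (π := π) (ρ := ρ) (lr := lr) (lc := lc) hg hlk
  have h3 := penalized_insert_le (π := π) (ρ := ρ) (lr := lr) (lc := lc) hg hm'
  have e1 := lineCard_erase π hk (π l)
  have e2 := lineCard_erase ρ hk (ρ l)
  have e3 := lineCard_erase ρ hk (ρ k)
  have e4 := lineCard_erase π hlk (π l)
  have e5 := lineCard_erase ρ hlk (ρ k)
  rw [if_neg hπ] at e1
  rw [if_neg hρ] at e2
  rw [if_pos rfl] at e3 e4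
  rw [if_neg hρ.symm] at e5
  rw [hmπ, hmρ, show lineCard π ((S.erase k).erase l) (π l) = 0 by omega,
    show lineCard ρ ((S.erase k).erase l) (ρ k) = 0 by omega] at h3
  rw [show lineCard π (S.erase k) (π l) = 1 by omega,
    show lineCard ρ (S.erase k) (ρ l) = lineCard ρ S (ρ l) by omega] at h2
  rw [hk1] at h1
  refine ⟨_, lt_of_le_of_lt h3 ?_⟩
  have ha2 : (2 : ℝ) ≤ lineCard π S (π k) := by exact_mod_cast ha
  have hb2 : (2 : ℝ) ≤ lineCard ρ S (ρ l) := by exact_mod_cast hb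
  have := hr k
  have := hc l
  have := hD k
  have := hM k
  have := hD l
  have := hM m
  have : 0 ≤ lr (π k) * (2 * lineCard π S (π k) - 4) :=
    mul_nonneg (by linarith) (by linarith)
  have : 0 ≤ lc (ρ l) * (2 * lineCard ρ S (ρ l) - 4) :=
    mul_nonneg (by linarith) (by linarith)
  push_cast at *
  linarith

lemma exists_penalized_lt_of_empty_of_empty
    (hg : ∀ S, ∀ p ∉ S, |g (insert p S) - g S| ≤ D p)
    (hD : ∀ p, 0 ≤ D p) (hM : ∀ p, D p ≤ M) (hr : ∀ p, D p + M / 2 < lr (π p))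
    (hc : ∀ p, D p + M / 2 < lc (ρ p))
    (hsurj : ∀ a b, ∃ p, π p = a ∧ ρ p = b) {S : Finset ι} {a : α} {b : β}
    (ha : lineCard π S a = 0) (hb : lineCard ρ S b = 0) :
    ∃ T, g T + linePenalty π lr T + linePenalty ρ lc T <
      g S + linePenalty π lr S + linePenalty ρ lc S := by
  obtain ⟨p, rfl, rfl⟩ := hsurj a b
  have hp : p ∉ S := fun h => (lineCard_pos (π := π) h).ne' ha
  refine ⟨_, lt_of_le_of_lt (penalized_insert_le hg hp) ?_⟩
  rw [ha, hb]
  have := hr p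
  have := hc p
  have := hD p
  have := hM p
  push_cast
  linarith

/-- A set that does not meet every fibre of `π` and `ρ` exactly once does not minimize the
penalized objective. -/
lemma exists_penalized_lt
    (hg : ∀ S, ∀ p ∉ S, |g (insert p S) - g S| ≤ D p)
    (hD : ∀ p, 0 ≤ D p) (hM : ∀ p, D p ≤ M) (hr : ∀ p, D p + M / 2 < lr (π p))
    (hc : ∀ p, D p + M / 2 < lc (ρ p))
    (hsurj : ∀ a b, ∃ p, π p = a ∧ ρ p = b) (hcard : Fintype.card α = Fintype.card β)
    {S : Finset ι} (hS : ¬ ((∀ a, lineCard π S a = 1) ∧ ∀ b, lineCard ρ S b = 1)) :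
    ∃ T, g T + linePenalty π lr T + linePenalty ρ lc T <
      g S + linePenalty π lr S + linePenalty ρ lc S := by
  have hπ := sum_lineCard π S
  have hρ := sum_lineCard ρ S
  by_cases h2 : (∃ a, 2 ≤ lineCard π S a) ∧ ∃ b, 2 ≤ lineCard ρ S b
  · obtain ⟨⟨a, ha⟩, b, hb⟩ := h2
    exact exists_penalized_lt_of_crowded_of_crowded hg hD hM hr hc hsurj ha hb
  by_cases h0 : (∃ a, lineCard π S a = 0) ∧ ∃ b, lineCard ρ S b = 0
  · obtain ⟨⟨a, ha⟩, b, hb⟩ := h0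
    exact exists_penalized_lt_of_empty_of_empty hg hD hM hr hc hsurj ha hb
  have hn : S.card = Fintype.card α := by
    rcases lt_trichotomy S.card (Fintype.card α) with h | h | h
    · exact absurd ⟨exists_eq_zero_of_lt_card (by omega),
        exists_eq_zero_of_lt_card (by omega)⟩ h0
    · exact h
    · exact absurd ⟨exists_two_le_of_card_lt (by omega),
        exists_two_le_of_card_lt (by omega)⟩ h2
  have hα : (∀ a, lineCard π S a = 1) ∨
      (∃ a, 2 ≤ lineCard π S a) ∧ ∃ a, lineCard π S a = 0 := by
    by_contra! h
    obtain ⟨⟨a, ha⟩, h⟩ := h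
    by_cases h' : ∃ a, 2 ≤ lineCard π S a
    · exact ha (eq_one_of_forall_one_le (hπ.trans hn)
        (fun a => Nat.one_le_iff_ne_zero.2 (h h' a)) a)
    · push Not at h'
      exact ha (eq_one_of_forall_le_one (hπ.trans hn) (fun a => Nat.le_of_lt_succ (h' a)) a)
  have hβ : (∀ b, lineCard ρ S b = 1) ∨
      (∃ b, 2 ≤ lineCard ρ S b) ∧ ∃ b, lineCard ρ S b = 0 := by
    by_contra! h
    obtain ⟨⟨b, hb⟩, h⟩ := h
    by_cases h' : ∃ b, 2 ≤ lineCard ρ S b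
    · exact hb (eq_one_of_forall_one_le (hρ.trans (hn.trans hcard))
        (fun a => Nat.one_le_iff_ne_zero.2 (h h' a)) b)
    · push Not at h'
      exact hb (eq_one_of_forall_le_one (hρ.trans (hn.trans hcard))
        (fun a => Nat.le_of_lt_succ (h' a)) b)
  rcases hα with hα | ⟨⟨a, ha⟩, a', ha'⟩
  · rcases hβ with hβ | ⟨⟨b, hb⟩, b', hb'⟩
    · exact absurd ⟨hα, hβ⟩ hS
    · obtain ⟨T, hT⟩ := exists_penalized_lt_of_crowded_of_empty (lc := lr) hg hD hM hc
        (fun b a => (hsurj a b).imp fun _ h => h.symm) hb hb' hα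
      exact ⟨T, by linarith⟩
  · rcases hβ with hβ | hβ
    · exact exists_penalized_lt_of_crowded_of_empty hg hD hM hr hsurj ha ha' hβ
    · exact absurd ⟨⟨a, ha⟩, hβ.1⟩ h2

end Penalty

section Quadratic

variable {ι : Type*} [Fintype ι] [DecidableEq ι]

/-- The quadratic function `xᵀWx + cᵀx` at the indicator vector of `S`. -/
noncomputable def indicatorQuadratic (W : Matrix ι ι ℝ) (c : ι → ℝ) (S : Finset ι) : ℝ :=
  (∑ p ∈ S, ∑ q ∈ S, W p q) + ∑ p ∈ S, c p

lemma abs_indicatorQuadratic_insert_sub_le (W : Matrix ι ι ℝ) (c : ι → ℝ) (S : Finset ι)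
    (k : ι) (hk : k ∉ S) :
    |indicatorQuadratic W c (insert k S) - indicatorQuadratic W c S| ≤
      (∑ i, |W k i + W i k|) + |W k k| + |c k| := by
  have h : indicatorQuadratic W c (insert k S) - indicatorQuadratic W c S =
      (∑ q ∈ S, (W k q + W q k)) + W k k + c k := by
    simp only [indicatorQuadratic, Finset.sum_insert hk, Finset.sum_add_distrib]
    ring
  rw [h]
  refine (abs_add_three _ _ _).trans ?_
  gcongr
  exact (Finset.abs_sum_le_sum_abs _ _).trans
    (Finset.sum_le_sum_of_subset_of_nonneg (Finset.subset_univ S) fun _ _ _ => abs_nonneg _)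

end Quadratic

lemma le_Dmax {n : ℕ} (W : Matrix (Fin n × Fin n) (Fin n × Fin n) ℝ)
    (c : (Fin n × Fin n) → ℝ) {J : Set (Fin n × Fin n)} {k : Fin n × Fin n} (hk : k ∈ J) :
    (∑ i, |W k i + W i k|) + |W k k| + |c k| ≤ Dmax W c J :=
  le_csSup (J.toFinite.image _).bddAbove (Set.mem_image_of_mem _ hk)

/-- Row-wise penalty reformulation: if `λ_i > D_{𝒥_i} + (1/2) D_{{1,…,n²}}` for every
constraint `i`, then the minimizers of `f(x) = xᵀWx + cᵀx` over binary `x` with `Ax = b`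
(all row and column sums of the corresponding matrix equal to 1) coincide with the
minimizers over all binary `x ∈ {0,1}^{n²}` of
`f(x) + Σ_i λ_i ((Ax)_i − b_i)²`. -/
theorem stmt_1 (n : ℕ) (hn : 2 ≤ n)
    (W : Matrix (Fin n × Fin n) (Fin n × Fin n) ℝ) (c : (Fin n × Fin n) → ℝ)
    (f : ((Fin n × Fin n) → ℝ) → ℝ)
    (hf : ∀ x, f x = (∑ p, ∑ q, x p * W p q * x q) + ∑ p, c p * x p)
    (Ax : ((Fin n × Fin n) → ℝ) → (Fin n ⊕ Fin n) → ℝ)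
    (hAx : ∀ x, (∀ j : Fin n, Ax x (Sum.inl j) = ∑ i, x (i, j)) ∧
                 (∀ i : Fin n, Ax x (Sum.inr i) = ∑ j, x (i, j)))
    (lam : Fin n ⊕ Fin n → ℝ)
    (hlam : ∀ t : Fin n ⊕ Fin n,
      lam t > Dmax W c (constrSet n t) + (1/2) * Dmax W c Set.univ) :
    ∀ x : (Fin n × Fin n) → ℝ, (∀ p, x p = 0 ∨ x p = 1) →
      (((∀ t, Ax x t = 1) ∧
          ∀ y : (Fin n × Fin n) → ℝ, (∀ p, y p = 0 ∨ y p = 1) →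
            (∀ t, Ax y t = 1) → f x ≤ f y) ↔
        (∀ y : (Fin n × Fin n) → ℝ, (∀ p, y p = 0 ∨ y p = 1) →
          f x + (∑ t, lam t * (Ax x t - 1)^2) ≤
            f y + ∑ t, lam t * (Ax y t - 1)^2)) := by
  set F : Finset (Fin n × Fin n) → ℝ := fun S => indicatorQuadratic W c S
    + linePenalty Prod.fst (fun i => lam (Sum.inr i)) S
    + linePenalty Prod.snd (fun j => lam (Sum.inl j)) S with hF
  let χ : Finset (Fin n × Fin n) → (Fin n × Fin n) → ℝ := fun S p => if p ∈ S then 1 else 0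
  have hχ : ∀ S p, χ S p = 0 ∨ χ S p = 1 := fun S p => by
    by_cases h : p ∈ S <;> simp [χ, h]
  have hχ_surj : ∀ x : (Fin n × Fin n) → ℝ, (∀ p, x p = 0 ∨ x p = 1) → ∃ S, x = χ S := by
    intro x hx
    refine ⟨Finset.univ.filter fun p => x p = 1, funext fun p => ?_⟩
    rcases hx p with h | h <;> simp [χ, h]
  have hrow : ∀ S i, Ax (χ S) (Sum.inr i) = lineCard Prod.fst S i := by
    intro S i
    rw [(hAx _).2, lineCard, Finset.card_filter, Nat.cast_sum, ← Fintype.sum_ite_mem S,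
      Fintype.sum_prod_type]
    simp only [Nat.cast_ite, Nat.cast_one, Nat.cast_zero, χ]
    symm
    rw [Finset.sum_eq_single i (fun b _ hb => by simp [hb]) (by simp)]
    simp
  have hcol : ∀ S j, Ax (χ S) (Sum.inl j) = lineCard Prod.snd S j := by
    intro S j
    rw [(hAx _).1, lineCard, Finset.card_filter, Nat.cast_sum, ← Fintype.sum_ite_mem S,
      Fintype.sum_prod_type_right]
    simp only [Nat.cast_ite, Nat.cast_one, Nat.cast_zero, χ]
    symm
    rw [Finset.sum_eq_single j (fun b _ hb => by simp [hb]) (by simp)]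
    simp
  have hfχ : ∀ S, f (χ S) = indicatorQuadratic W c S := by
    intro S
    simp [hf, χ, indicatorQuadratic, Finset.sum_ite_mem]
  have hFχ : ∀ S, f (χ S) + ∑ t, lam t * (Ax (χ S) t - 1) ^ 2 = F S := by
    intro S
    simp only [Fintype.sum_sum_type, hrow, hcol, hfχ, hF, linePenalty]
    ring
  have hfeas : ∀ S, (∀ t, Ax (χ S) t = 1) ↔
      (∀ i, lineCard Prod.fst S i = 1) ∧ ∀ j, lineCard Prod.snd S j = 1 := by
    intro S
    simp only [Sum.forall, hrow, hcol, Nat.cast_eq_one]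
    exact and_comm
  have hFf : ∀ S, (∀ t, Ax (χ S) t = 1) → F S = f (χ S) := by
    intro S hS
    rw [← hFχ]
    simp [hS]
  have hdesc : ∀ S, ¬ (∀ t, Ax (χ S) t = 1) → ∃ T, F T < F S := by
    intro S hS
    refine exists_penalized_lt (π := Prod.fst) (ρ := Prod.snd)
      (abs_indicatorQuadratic_insert_sub_le W c) (M := Dmax W c Set.univ)
      (fun p => by positivity) (fun p => le_Dmax W c (Set.mem_univ p)) (fun p => ?_) (fun p => ?_)
      (fun a b => ⟨(a, b), rfl, rfl⟩) rfl (fun h => hS ((hfeas S).2 h))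
    · have h1 := hlam (Sum.inr p.1)
      have h2 := le_Dmax W c (show p ∈ constrSet n (Sum.inr p.1) from rfl)
      linarith
    · have h1 := hlam (Sum.inl p.2)
      have h2 := le_Dmax W c (show p ∈ constrSet n (Sum.inl p.2) from rfl)
      linarith
  intro x hx
  obtain ⟨S, rfl⟩ := hχ_surj x hx
  constructor
  · rintro ⟨hS, hmin⟩ y hy
    obtain ⟨T, rfl⟩ := hχ_surj y hy
    rw [hFχ, hFχ]
    obtain ⟨U, hU⟩ := Finite.exists_min F
    have hUfeas : ∀ t, Ax (χ U) t = 1 := by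
      by_contra h
      obtain ⟨V, hV⟩ := hdesc U h
      exact (hU V).not_gt hV
    calc F S = f (χ S) := hFf S hS
      _ ≤ f (χ U) := hmin _ (hχ U) hUfeas
      _ = F U := (hFf U hUfeas).symm
      _ ≤ F T := hU T
  · intro hmin
    have hS : ∀ t, Ax (χ S) t = 1 := by
      by_contra h
      obtain ⟨T, hT⟩ := hdesc S h
      have := hmin _ (hχ T)
      rw [hFχ, hFχ] at this
      exact this.not_gt hT
    refine ⟨hS, fun y hy hyfeas => ?_⟩
    have h := hmin y hy
    obtain ⟨T, rfl⟩ := hχ_surj y hy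
    rwa [hFχ, hFχ, hFf S hS, hFf T hyfeas] at h
end

section
/- For n ≥ 2, the set of n×n permutation matrices equals the set of matrices of the form X with X_{1,1} = 2 − n + Σ_{i,j=2}^n x_{i,j}, X_{1,j} = 1 − Σ_{i=2}^n x_{i,j} for j ≥ 2, X_{i,1} = 1 − Σ_{j=2}^n x_{i,j} for i ≥ 2, and X_{i,j} = x_{i,j} for i,j ≥ 2, where the parameters satisfy: x_{i,j} ∈ {0,1} for all i,j ∈ {2,…,n}; Σ_{i,j=2}^n x_{i,j} ∈ {n−2, n−1}; and for all j,i,k ∈ {2,…,n} with i ≠ k, x_{j,i} x_{j,k} = 0 and x_{i,j} x_{k,j} = 0. -/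
/-- The map building an `n×n` matrix from parameters `x_{i,j}`, `i,j ∈ {2,…,n}`
(represented as an `(n−1)×(n−1)` matrix `Y`):
`X_{1,1} = 2 − n + Σ_{i,j≥2} x_{i,j}`, `X_{1,j} = 1 − Σ_{i≥2} x_{i,j}` for `j ≥ 2`,
`X_{i,1} = 1 − Σ_{j≥2} x_{i,j}` for `i ≥ 2`, and `X_{i,j} = x_{i,j}` for `i,j ≥ 2`. -/
noncomputable def Phi (n : ℕ) (Y : Matrix (Fin (n - 1)) (Fin (n - 1)) ℝ) :
    Matrix (Fin n) (Fin n) ℝ := fun i j =>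
  if hi : i.val = 0 then
    if hj : j.val = 0 then 2 - (n : ℝ) + ∑ a, ∑ b, Y a b
    else 1 - ∑ a, Y a ⟨j.val - 1, by omega⟩
  else
    if hj : j.val = 0 then 1 - ∑ b, Y ⟨i.val - 1, by omega⟩ b
    else Y ⟨i.val - 1, by omega⟩ ⟨j.val - 1, by omega⟩

theorem sum_eq_zero_or_one_of_mul_eq_zero {m : ℕ} {f : Fin m → ℝ}
    (hf : ∀ i, f i = 0 ∨ f i = 1) (h : ∀ i k, i ≠ k → f i * f k = 0) :
    ∑ i, f i = 0 ∨ ∑ i, f i = 1 := by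
  by_cases hex : ∃ i, f i = 1
  · obtain ⟨i, hi⟩ := hex
    right
    rw [Finset.sum_eq_single i _ (by simp), hi]
    intro k _ hk
    simpa [hi] using h i k hk.symm
  · left
    exact Finset.sum_eq_zero fun i _ => (hf i).resolve_right fun hi => hex ⟨i, hi⟩

theorem mul_eq_zero_of_sum_eq_one {m : ℕ} {f : Fin m → ℝ}
    (hf : ∀ i, f i = 0 ∨ f i = 1) (h : ∑ i, f i = 1) {i k : Fin m} (hik : i ≠ k) :
    f i * f k = 0 := by
  have hle : ∑ a ∈ {i, k}, f a ≤ ∑ a, f a :=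
    Finset.sum_le_sum_of_subset_of_nonneg (Finset.subset_univ _) fun a _ _ => by
      rcases hf a with ha | ha <;> simp [ha]
  rw [Finset.sum_pair hik, h] at hle
  rcases hf i with hi | hi
  · simp [hi]
  · rcases hf k with hk | hk
    · simp [hk]
    · norm_num [hi, hk] at hle

theorem Phi_zero_zero (m : ℕ) (Y : Matrix (Fin m) (Fin m) ℝ) :
    Phi (m + 1) Y 0 0 = 1 - (m : ℝ) + ∑ a, ∑ b, Y a b := by
  change 2 - ((m + 1 : ℕ) : ℝ) + ∑ a : Fin m, ∑ b : Fin m, Y a b = _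
  push_cast
  ring

theorem Phi_zero_succ (m : ℕ) (Y : Matrix (Fin m) (Fin m) ℝ) (j : Fin m) :
    Phi (m + 1) Y 0 j.succ = 1 - ∑ a, Y a j := rfl

theorem Phi_succ_zero (m : ℕ) (Y : Matrix (Fin m) (Fin m) ℝ) (i : Fin m) :
    Phi (m + 1) Y i.succ 0 = 1 - ∑ b, Y i b := rfl

theorem Phi_succ_succ (m : ℕ) (Y : Matrix (Fin m) (Fin m) ℝ) (i j : Fin m) :
    Phi (m + 1) Y i.succ j.succ = Y i j := rfl

/-- For `n ≥ 2`, the set of `n×n` permutation matrices equals the set of matrices of the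
form `Phi n Y`, where the parameters `Y_{i,j}` (for `i,j ∈ {2,…,n}`) are binary, their
total sum lies in `{n−2, n−1}`, and for all `j, i, k ∈ {2,…,n}` with `i ≠ k` we have
`Y_{j,i} Y_{j,k} = 0` and `Y_{i,j} Y_{k,j} = 0`. -/
theorem stmt_2 (n : ℕ) (hn : 2 ≤ n) (X : Matrix (Fin n) (Fin n) ℝ) :
    ((∀ i j, X i j = 0 ∨ X i j = 1) ∧ (∀ i, ∑ j, X i j = 1) ∧ (∀ j, ∑ i, X i j = 1)) ↔
    (∃ Y : Matrix (Fin (n - 1)) (Fin (n - 1)) ℝ,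
      (∀ i j, Y i j = 0 ∨ Y i j = 1) ∧
      ((∑ i, ∑ j, Y i j) = (n : ℝ) - 2 ∨ (∑ i, ∑ j, Y i j) = (n : ℝ) - 1) ∧
      (∀ j i k : Fin (n - 1), i ≠ k → Y j i * Y j k = 0 ∧ Y i j * Y k j = 0) ∧
      X = Phi n Y) := by
  obtain ⟨m, rfl⟩ : ∃ m, n = m + 1 := ⟨n - 1, by omega⟩
  change _ ↔ ∃ Y : Matrix (Fin m) (Fin m) ℝ,
    (∀ i j, Y i j = 0 ∨ Y i j = 1) ∧
    ((∑ i, ∑ j, Y i j) = ((m + 1 : ℕ) : ℝ) - 2 ∨ (∑ i, ∑ j, Y i j) = ((m + 1 : ℕ) : ℝ) - 1) ∧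
    (∀ j i k : Fin m, i ≠ k → Y j i * Y j k = 0 ∧ Y i j * Y k j = 0) ∧
    X = Phi (m + 1) Y
  push_cast
  constructor
  · rintro ⟨hX, hrow, hcol⟩
    have hr (i) : X i 0 + ∑ b : Fin m, X i b.succ = 1 := by
      rw [← Fin.sum_univ_succ]; exact hrow i
    have hc (j) : X 0 j + ∑ a : Fin m, X a.succ j = 1 := by
      rw [← Fin.sum_univ_succ (f := fun a => X a j)]; exact hcol j
    have htot : ∑ a : Fin m, ∑ b : Fin m, X a.succ b.succ = (m : ℝ) - 1 + X 0 0 := by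
      have hi (a : Fin m) : ∑ b : Fin m, X a.succ b.succ = 1 - X a.succ 0 := by
        linarith [hr a.succ]
      simp only [hi, Finset.sum_sub_distrib, Finset.sum_const, Finset.card_univ,
        Fintype.card_fin, nsmul_eq_mul, mul_one]
      linarith [hc 0]
    refine ⟨X.submatrix Fin.succ Fin.succ, fun i j => hX _ _, ?_, ?_, ?_⟩
    · rcases hX 0 0 with h | h
      · left; simp only [Matrix.submatrix_apply]; rw [htot, h]; ring
      · right; simp only [Matrix.submatrix_apply]; rw [htot, h]; ring
    · intro j i k hik
      have hs : i.succ ≠ k.succ := (Fin.succ_injective m).ne hik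
      exact ⟨mul_eq_zero_of_sum_eq_one (hX j.succ) (hrow j.succ) hs,
        mul_eq_zero_of_sum_eq_one (fun a => hX a j.succ) (hcol j.succ) hs⟩
    · ext i j
      cases i using Fin.cases with
      | zero =>
        cases j using Fin.cases with
        | zero =>
          have h00 : X 0 0 = 1 - (m : ℝ) + ∑ a : Fin m, ∑ b : Fin m, X a.succ b.succ := by
            linarith
          exact h00.trans
            (Phi_zero_zero m (X.submatrix Fin.succ Fin.succ)).symm
        | succ j =>
          exact (eq_sub_of_add_eq (hc j.succ)).trans
            (Phi_zero_succ m (X.submatrix Fin.succ Fin.succ) j).symm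
      | succ i =>
        cases j using Fin.cases with
        | zero =>
          exact (eq_sub_of_add_eq (hr i.succ)).trans
            (Phi_succ_zero m (X.submatrix Fin.succ Fin.succ) i).symm
        | succ j => exact (Phi_succ_succ m (X.submatrix Fin.succ Fin.succ) i j).symm
  · rintro ⟨Y, hY, htot, hmul, rfl⟩
    refine ⟨fun i j => ?_, fun i => ?_, fun j => ?_⟩
    · cases i using Fin.cases with
      | zero =>
        cases j using Fin.cases with
        | zero =>
          rw [Phi_zero_zero]
          rcases htot with h | h
          · left; linarith
          · right; linarith
        | succ j =>
          rw [Phi_zero_succ]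
          rcases sum_eq_zero_or_one_of_mul_eq_zero (fun a => hY a j)
            (fun i k hik => (hmul j i k hik).2) with h | h <;> simp [h]
      | succ i =>
        cases j using Fin.cases with
        | zero =>
          rw [Phi_succ_zero]
          rcases sum_eq_zero_or_one_of_mul_eq_zero (hY i)
            (fun j k hjk => (hmul i j k hjk).1) with h | h <;> simp [h]
        | succ j => exact hY i j
    · rw [Fin.sum_univ_succ]
      cases i using Fin.cases with
      | zero =>
        simp only [Phi_zero_zero, Phi_zero_succ, Finset.sum_sub_distrib, Finset.sum_const,
          Finset.card_univ, Fintype.card_fin, nsmul_eq_mul, mul_one]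
        rw [Finset.sum_comm]
        ring
      | succ i => simp only [Phi_succ_zero, Phi_succ_succ]; ring
    · rw [Fin.sum_univ_succ]
      cases j using Fin.cases with
      | zero =>
        simp only [Phi_zero_zero, Phi_succ_zero, Finset.sum_sub_distrib, Finset.sum_const,
          Finset.card_univ, Fintype.card_fin, nsmul_eq_mul, mul_one]
        ring
      | succ j => simp only [Phi_zero_succ, Phi_succ_succ]; ring
end

section
/- Let A be a real m×N matrix, b ∈ ℝ^m, W a real N×N matrix and c ∈ ℝ^N; suppose both the feasible set {x ∈ {0,1}^N : Ax = b} and the infeasible set {x ∈ {0,1}^N : Ax ≠ b} are nonempty, and let d := min { ‖Ax − b‖² : x ∈ {0,1}^N, Ax ≠ b } (so d > 0). If λ > (1/d)(Σ_{i,j} |W_{i,j}| + Σ_i |c_i|), then min_{x ∈ {0,1}^N, Ax = b} (xᵀWx + cᵀx) < min_{x ∈ {0,1}^N, Ax ≠ b} (xᵀWx + cᵀx + λ‖Ax − b‖²); consequently every minimizer of xᵀWx + cᵀx + λ‖Ax − b‖² over {0,1}^N satisfies Ax = b and is a minimizer of xᵀWx + cᵀx over the feasible set. -/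
/-- Multiples of `w` by two numbers in the unit interval differ by at most `|w|`. -/
lemma mul_le_mul_add_abs_of_mem_Icc {w s t : ℝ} (hs : s ∈ Set.Icc 0 1) (ht : t ∈ Set.Icc 0 1) :
    w * s ≤ w * t + |w| := by
  have h : |s - t| ≤ 1 := abs_sub_le_iff.2 ⟨by linarith [hs.2, ht.1], by linarith [ht.2, hs.1]⟩
  have h₁ : w * (s - t) ≤ |w| := calc
    w * (s - t) ≤ |w * (s - t)| := le_abs_self _
    _ = |w| * |s - t| := abs_mul _ _
    _ ≤ |w| := mul_le_of_le_one_right (abs_nonneg _) h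
  linarith

/-- A quadratic function oscillates on the unit cube by at most the sum of the absolute values
of its coefficients. -/
lemma quadratic_le_add_sum_abs {ι : Type*} [Fintype ι] (W : Matrix ι ι ℝ) (c : ι → ℝ)
    {x y : ι → ℝ} (hx : ∀ i, x i ∈ Set.Icc 0 1) (hy : ∀ i, y i ∈ Set.Icc 0 1) :
    (∑ i, ∑ j, x i * W i j * x j) + ∑ i, c i * x i ≤
      (∑ i, ∑ j, y i * W i j * y j) + ∑ i, c i * y i +
        ((∑ i, ∑ j, |W i j|) + ∑ i, |c i|) := by
  have hW : ∑ i, ∑ j, x i * W i j * x j ≤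
      (∑ i, ∑ j, y i * W i j * y j) + ∑ i, ∑ j, |W i j| := by
    simp only [← Finset.sum_add_distrib]
    refine Finset.sum_le_sum fun i _ => Finset.sum_le_sum fun j _ => ?_
    rw [mul_comm (x i), mul_comm (y i), mul_assoc, mul_assoc]
    exact mul_le_mul_add_abs_of_mem_Icc (unitInterval.mul_mem (hx i) (hx j))
      (unitInterval.mul_mem (hy i) (hy j))
  have hc : ∑ i, c i * x i ≤ (∑ i, c i * y i) + ∑ i, |c i| := by
    rw [← Finset.sum_add_distrib]
    exact Finset.sum_le_sum fun i _ => mul_le_mul_add_abs_of_mem_Icc (hx i) (hy i)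
  linarith

/-- The squared Euclidean distance of distinct vectors is positive. -/
lemma sum_sq_sub_pos_of_ne {ι : Type*} [Fintype ι] {u v : ι → ℝ} (h : u ≠ v) :
    0 < ∑ i, (u i - v i) ^ 2 := by
  obtain ⟨i, hi⟩ := Function.ne_iff.1 h
  exact Finset.sum_pos' (fun j _ => sq_nonneg _)
    ⟨i, Finset.mem_univ i, by have := sub_ne_zero.2 hi; positivity⟩

/-- General penalty lemma: if both the feasible set `{x ∈ {0,1}^N : Ax = b}` and the
infeasible set are nonempty, `d` is the minimum of `‖Ax − b‖²` over infeasible binary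
vectors (so `d > 0`), and `λ > (1/d)(Σ_{i,j} |W_{i,j}| + Σ_i |c_i|)`, then
`min_{Ax=b} (xᵀWx + cᵀx) < min_{Ax≠b} (xᵀWx + cᵀx + λ‖Ax − b‖²)`; consequently every
minimizer of the penalized objective over `{0,1}^N` is feasible and minimizes
`xᵀWx + cᵀx` over the feasible set. -/
theorem stmt_4 (m N : ℕ) (A : Matrix (Fin m) (Fin N) ℝ) (b : Fin m → ℝ)
    (W : Matrix (Fin N) (Fin N) ℝ) (c : Fin N → ℝ)
    (f : (Fin N → ℝ) → ℝ)
    (hf : ∀ x, f x = (∑ i, ∑ j, x i * W i j * x j) + ∑ i, c i * x i)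
    (hfeas : ∃ x : Fin N → ℝ, (∀ i, x i = 0 ∨ x i = 1) ∧ A.mulVec x = b)
    (hinfeas : ∃ x : Fin N → ℝ, (∀ i, x i = 0 ∨ x i = 1) ∧ A.mulVec x ≠ b)
    (d : ℝ)
    (hd : IsLeast {v : ℝ | ∃ x : Fin N → ℝ, (∀ i, x i = 0 ∨ x i = 1) ∧
      A.mulVec x ≠ b ∧ v = ∑ i, (A.mulVec x i - b i)^2} d)
    (lam : ℝ)
    (hlam : lam > (1/d) * ((∑ i, ∑ j, |W i j|) + ∑ i, |c i|)) :
    0 < d ∧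
    (∃ x : Fin N → ℝ, (∀ i, x i = 0 ∨ x i = 1) ∧ A.mulVec x = b ∧
      ∀ y : Fin N → ℝ, (∀ i, y i = 0 ∨ y i = 1) → A.mulVec y ≠ b →
        f x < f y + lam * ∑ i, (A.mulVec y i - b i)^2) ∧
    (∀ z : Fin N → ℝ, (∀ i, z i = 0 ∨ z i = 1) →
      (∀ y : Fin N → ℝ, (∀ i, y i = 0 ∨ y i = 1) →
        f z + lam * (∑ i, (A.mulVec z i - b i)^2) ≤
          f y + lam * ∑ i, (A.mulVec y i - b i)^2) →
      A.mulVec z = b ∧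
        ∀ x : Fin N → ℝ, (∀ i, x i = 0 ∨ x i = 1) → A.mulVec x = b → f z ≤ f x) := by
  have hd0 : 0 < d := by
    obtain ⟨x, -, hx, rfl⟩ := hd.1
    exact sum_sq_sub_pos_of_ne hx
  have hlamd : (∑ i, ∑ j, |W i j|) + ∑ i, |c i| < lam * d := by
    rwa [gt_iff_lt, one_div_mul_eq_div, div_lt_iff₀ hd0] at hlam
  have hlam0 : 0 ≤ lam := le_of_lt (lt_of_le_of_lt (by positivity) hlam)
  have hIcc : ∀ x : Fin N → ℝ, (∀ i, x i = 0 ∨ x i = 1) → ∀ i, x i ∈ Set.Icc 0 1 := by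
    intro x hx i
    rcases hx i with h | h <;> simp [h]
  have key : ∀ x y : Fin N → ℝ, (∀ i, x i = 0 ∨ x i = 1) → (∀ i, y i = 0 ∨ y i = 1) →
      A.mulVec y ≠ b → f x < f y + lam * ∑ i, (A.mulVec y i - b i)^2 := by
    intro x y hx hy hyb
    have hdy : lam * d ≤ lam * ∑ i, (A.mulVec y i - b i)^2 :=
      mul_le_mul_of_nonneg_left (hd.2 ⟨y, hy, hyb, rfl⟩) hlam0
    have hosc := quadratic_le_add_sum_abs W c (hIcc x hx) (hIcc y hy)
    rw [hf x, hf y]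
    linarith
  obtain ⟨x₀, hx₀, hx₀b⟩ := hfeas
  refine ⟨hd0, ⟨x₀, hx₀, hx₀b, fun y => key x₀ y hx₀⟩, fun z hz hmin => ?_⟩
  have hzb : A.mulVec z = b := by
    by_contra hzb
    have h := hmin x₀ hx₀
    simp only [hx₀b, sub_self, ne_eq, OfNat.ofNat_ne_zero, not_false_eq_true, zero_pow,
      Finset.sum_const_zero, mul_zero, add_zero] at h
    exact (key x₀ z hx₀ hz hzb).not_ge h
  exact ⟨hzb, fun x hx hxb => by simpa [hzb, hxb] using hmin x hx⟩
end
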